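/- Let ε ≥ 0, let l ≥ 4 be an integer, and let 𝓡(ϱ,s,θ) be of class C^l, 2π_p-periodic in s and in θ, and satisfy |D_ϱ^i D_s^j 𝓡(ϱ,s,θ)| ≤ C · ϱ^{-ε - i/q} for all 0 ≤ i+j ≤ l and all sufficiently large ϱ. Set [𝓡]₀(ϱ) = (1/2π_p)² ∫₀^{2π_p}∫₀^{2π_p} 𝓡(ϱ,s,θ) ds dθ. Then there exists a function S₃(ϱ,s,θ), 2π_p-periodic in s and in θ, satisfying the first-order linear equation ω ∂S₃/∂s + ∂S₃/∂θ + 𝓡(ϱ,s,θ) − [𝓡]₀(ϱ) = 0 together with the estimates |D_ϱ^i D_s^j S₃(ϱ,s,θ)| ≤ C' · ϱ^{-ε - i/q} for all 0 ≤ i+j ≤ l−2 and all sufficiently large ϱ. -/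

import Mathlib

/-- The `p`-analogue of `π`: `π_p = 2π (p-1)^{1/p} / (p sin(π/p))`. -/
noncomputable def pip (p : ℝ) : ℝ :=
  2 * Real.pi * (p - 1) ^ (1 / p) / (p * Real.sin (Real.pi / p))

/-- Mixed partial derivative `D_x^i D_t^j F(x,t)` of a function of two real variables. -/
noncomputable def iterD (F : ℝ → ℝ → ℝ) (i j : ℕ) (x t : ℝ) : ℝ :=
  iteratedDeriv i (fun y => iteratedDeriv j (F y) t) x

open MeasureTheory Set Filter Topology

theorem norm_exp_two_pi_sub_one_ge (x : ℝ) :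
    4 * |x - round x| ≤ ‖Complex.exp (2 * Real.pi * Complex.I * x) - 1‖ := by
  have h1 : Complex.exp (2 * Real.pi * Complex.I * x)
      = Complex.exp (Complex.I * ((2 * Real.pi * (x - round x) : ℝ) : ℂ)) := by
    rw [Complex.exp_eq_exp_iff_exists_int]
    exact ⟨round x, by push_cast; ring⟩
  rw [h1, Complex.norm_exp_I_mul_ofReal_sub_one]
  have h2 := abs_sub_round x
  have hpi := Real.pi_pos
  have h3 := Real.mul_abs_le_abs_sin (x := 2 * Real.pi * (x - round x) / 2) (by
    rw [show 2 * Real.pi * (x - round x) / 2 = Real.pi * (x - round x) by ring, abs_mul,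
      abs_of_pos hpi]
    nlinarith)
  rw [show 2 * Real.pi * (x - round x) / 2 = Real.pi * (x - round x) by ring] at h3 ⊢
  rw [abs_mul, abs_of_pos hpi] at h3
  rw [Real.norm_eq_abs, abs_mul, abs_two]
  have : 2 / Real.pi * (Real.pi * |x - round x|) = 2 * |x - round x| := by field_simp
  linarith

theorem inv_sq_le_of_one_le_abs {y : ℝ} (hy : 1 ≤ |y|) :
    (y ^ 2)⁻¹ ≤ 5 * (1 + (⌊y⌋ : ℝ) ^ 2)⁻¹ := by
  have h1 := Int.floor_le y
  have h2 := Int.lt_floor_add_one y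
  have hy2 : 0 < y ^ 2 := by rw [← sq_abs]; positivity
  rw [← div_eq_mul_inv, inv_eq_one_div, div_le_div_iff₀ hy2 (by positivity)]
  have : |(⌊y⌋ : ℝ)| ≤ |y| + 1 := by
    rw [abs_le]; constructor <;> cases abs_cases y <;> linarith
  rw [← sq_abs (⌊y⌋ : ℝ), ← sq_abs y]
  nlinarith [abs_nonneg (⌊y⌋ : ℝ)]

theorem summable_inv_one_add_int_sq : Summable fun n : ℤ => (1 + (n : ℝ) ^ 2)⁻¹ := by
  have h0 : Summable fun n : ℤ => 1 / (n : ℝ) ^ 2 :=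
    Real.summable_one_div_int_pow.mpr one_lt_two
  refine (summable_of_ne_finset_zero (s := {0}) (f := fun n : ℤ => if n = 0 then (1:ℝ) else 0)
    (by intro b hb; simp at hb; simp [hb]) |>.add h0).of_nonneg_of_le
    (fun n => by positivity) fun n => ?_
  by_cases hn : n = 0
  · simp [hn]
  · have : (n : ℝ) ≠ 0 := by exact_mod_cast hn
    simp only [hn, if_false, zero_add, one_div]
    gcongr
    linarith

theorem summable_inv_pow_four_mul_inv_sq_dist_round {ω γ τ : ℝ} (hτ0 : 0 < τ) (hτ2 : τ < 2)
    (hγ : 0 < γ)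
    (hdio : ∀ m n : ℤ, (m, n) ≠ (0, 0) → γ / |(m : ℝ)| ^ τ ≤ |(m : ℝ) * ω + (n : ℝ)|) :
    Summable fun m : ℤ => ((m : ℝ) ^ 4)⁻¹ * ((m * ω - round (m * ω)) ^ 2)⁻¹ := by
  have key : ∀ (N : ℝ) (m n : ℤ), m ≠ 0 → |(m : ℝ)| ≤ N →
      γ / N ^ τ ≤ |(m : ℝ) * ω + (n : ℝ)| := by
    intro N m n hm hN
    have hm' : 0 < |(m : ℝ)| := by positivity
    refine le_trans ?_ (hdio m n (by simp [hm]))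
    gcongr
  set x : ℤ → ℝ := fun m => m * ω - round (m * ω) with hx
  set δ : ℕ → ℝ := fun k => γ / ((2 : ℝ) ^ (k + 2)) ^ τ with hδ
  have hδ0 : ∀ k, 0 < δ k := fun k => by positivity
  have hlog : ∀ m : ℤ, m ≠ 0 → (2 : ℝ) ^ (Nat.log 2 m.natAbs) ≤ |(m : ℝ)| ∧
      |(m : ℝ)| ≤ 2 ^ (Nat.log 2 m.natAbs + 1) := by
    intro m hm
    have e : |(m : ℝ)| = (m.natAbs : ℝ) := by rw [Nat.cast_natAbs]; push_cast; rfl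
    rw [e]
    exact ⟨by exact_mod_cast Nat.pow_log_le_self 2 (by simpa using hm),
      by exact_mod_cast (Nat.lt_pow_succ_log_self one_lt_two _).le⟩
  let φ : {m : ℤ // m ≠ 0} → ℕ × ℤ := fun m =>
    (Nat.log 2 m.1.natAbs, ⌊x m.1 / δ (Nat.log 2 m.1.natAbs)⌋)
  have hφ : Function.Injective φ := by
    rintro ⟨m, hm⟩ ⟨m', hm'⟩ h
    simp only [φ, Prod.mk.injEq] at h
    obtain ⟨hk, hf⟩ := h
    have h1 := hlog m hm
    have h2 := hlog m' hm'
    rw [← hk] at hf h2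
    set k := Nat.log 2 m.natAbs
    by_contra hne
    have hne' : m - m' ≠ 0 := fun h => hne (by simpa [sub_eq_zero] using h)
    have h3 := key (2 ^ (k + 2)) (m - m') (round (m' * ω) - round (m * ω)) hne' (by
      push_cast
      calc |(m : ℝ) - m'| ≤ |(m : ℝ)| + |(m' : ℝ)| := abs_sub _ _
        _ ≤ 2 ^ (k + 1) + 2 ^ (k + 1) := add_le_add h1.2 h2.2
        _ = 2 ^ (k + 2) := by ring)
    have h4 := Int.abs_sub_lt_one_of_floor_eq_floor hf
    rw [← sub_div, abs_div, abs_of_pos (hδ0 k), div_lt_one (hδ0 k)] at h4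
    have h5 : x m - x m' = ((m - m' : ℤ) : ℝ) * ω + ((round (m' * ω) - round (m * ω) : ℤ) : ℝ) := by
      simp only [hx]; push_cast; ring
    rw [h5] at h4
    exact absurd h4 (not_lt.mpr h3)
  set r : ℝ := (2 : ℝ) ^ (2 * τ) / 2 ^ 4 with hr
  have hr1 : r < 1 := by
    rw [hr, div_lt_one (by norm_num)]
    calc (2 : ℝ) ^ (2 * τ) < 2 ^ (4 : ℝ) :=
          Real.rpow_lt_rpow_of_exponent_lt one_lt_two (by linarith)
      _ = 2 ^ 4 := by norm_num
  have hr0 : 0 ≤ r := by positivity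
  have hs : Summable fun z : ℕ × ℤ => r ^ z.1 * (1 + (z.2 : ℝ) ^ 2)⁻¹ :=
    (summable_geometric_of_lt_one hr0 hr1).mul_of_nonneg summable_inv_one_add_int_sq
      (fun k => by positivity) (fun n => by positivity)
  have hs' : Summable fun m : {m : ℤ // m ≠ 0} =>
      5 * (4 ^ (2 * τ) / γ ^ 2) * (r ^ (φ m).1 * (1 + ((φ m).2 : ℝ) ^ 2)⁻¹) :=
    (hs.comp_injective hφ).mul_left _
  have hsub : Summable fun m : {m : ℤ // m ≠ 0} => ((m.1 : ℝ) ^ 4)⁻¹ * ((x m.1) ^ 2)⁻¹ := by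
    refine hs'.of_nonneg_of_le (fun m => by positivity) ?_
    rintro ⟨m, hm⟩
    have h1 := hlog m hm
    simp only [φ]
    set k := Nat.log 2 m.natAbs
    have h3 := key (2 ^ (k + 2)) m (-round (m * ω)) hm (h1.2.trans (by gcongr <;> simp))
    have h5 : x m = (m : ℝ) * ω + ((-round (m * ω) : ℤ) : ℝ) := by
      simp only [hx]; push_cast; ring
    rw [← h5] at h3
    have h6 : 1 ≤ |x m / δ k| := by
      rw [abs_div, abs_of_pos (hδ0 k), one_le_div (hδ0 k)]; exact h3
    have h7 := inv_sq_le_of_one_le_abs h6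
    have h8 : ((x m) ^ 2)⁻¹ = (δ k ^ 2)⁻¹ * ((x m / δ k) ^ 2)⁻¹ := by
      have aux : ∀ a d : ℝ, d ≠ 0 → (a ^ 2)⁻¹ = (d ^ 2)⁻¹ * ((a / d) ^ 2)⁻¹ := by
        intro a d hd
        field_simp
      exact aux _ _ (hδ0 k).ne'
    have h9 : ((m : ℝ) ^ 4)⁻¹ ≤ (((2 : ℝ) ^ k) ^ 4)⁻¹ := by
      rw [← Even.pow_abs (by decide) (m : ℝ)]
      gcongr
      exact h1.1
    have h10 : (((2 : ℝ) ^ k) ^ 4)⁻¹ * (δ k ^ 2)⁻¹ = 4 ^ (2 * τ) / γ ^ 2 * r ^ k := by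
      have e1 : (((2 : ℝ) ^ (k + 2)) ^ τ) ^ 2 = 4 ^ (2 * τ) * (2 ^ (2 * τ)) ^ k := by
        rw [← Real.rpow_natCast _ 2, ← Real.rpow_mul (by positivity), pow_add,
          Real.mul_rpow (by positivity) (by positivity), mul_comm]
        congr 1
        · norm_num [mul_comm]
        · rw [← Real.rpow_natCast, ← Real.rpow_natCast, ← Real.rpow_mul (by positivity),
            ← Real.rpow_mul (by positivity)]
          congr 1; push_cast; ring
      rw [hδ, hr]
      simp only [div_pow]
      rw [e1, ← pow_mul, ← pow_mul, mul_comm 4 k]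
      field_simp
    rw [h8]
    calc ((m : ℝ) ^ 4)⁻¹ * ((δ k ^ 2)⁻¹ * ((x m / δ k) ^ 2)⁻¹)
        ≤ (((2 : ℝ) ^ k) ^ 4)⁻¹ * ((δ k ^ 2)⁻¹ * (5 * (1 + (⌊x m / δ k⌋ : ℝ) ^ 2)⁻¹)) := by
          gcongr
      _ = 5 * ((((2 : ℝ) ^ k) ^ 4)⁻¹ * (δ k ^ 2)⁻¹) * (1 + (⌊x m / δ k⌋ : ℝ) ^ 2)⁻¹ := by ring
      _ = _ := by rw [h10]; ring
  have hsupp : Function.support (fun m : ℤ => ((m : ℝ) ^ 4)⁻¹ * ((x m) ^ 2)⁻¹) ⊆ {m | m ≠ 0} := by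
    intro m hm h0
    exact hm (by simp [show m = 0 from h0])
  exact (Function.Injective.summable_iff Subtype.coe_injective (fun m hm => by
    by_contra h; exact hm ⟨⟨m, hsupp h⟩, rfl⟩)).mp hsub

/-- The continuous function on the circle `ℝ / Tℤ` induced by a real continuous `T`-periodic
function. -/
noncomputable def circleLift {T : ℝ} (h : ℝ → ℝ) (hc : Continuous h)
    (hper : Function.Periodic h T) :
    C(AddCircle T, ℂ) where
  toFun x := (hper.lift x : ℂ)
  continuous_toFun := Complex.continuous_ofReal.comp (continuous_coinduced_dom.mpr hc)

theorem circleLift_coe {T : ℝ} (h : ℝ → ℝ) (hc : Continuous h)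
    (hper : Function.Periodic h T) (x : ℝ) :
    circleLift h hc hper (x : AddCircle T) = h x := rfl

theorem fourierCoeff_circleLift_deriv {T : ℝ} [hT : Fact (0 < T)] {h : ℝ → ℝ}
    (hh : ContDiff ℝ 1 h)
    (hper : Function.Periodic h T) (hc' : Continuous (deriv h))
    (hper' : Function.Periodic (deriv h) T) {n : ℤ} (hn : n ≠ 0) :
    fourierCoeff (circleLift h hh.continuous hper) n
      = T / (2 * Real.pi * Complex.I * n) * fourierCoeff (circleLift (deriv h) hc' hper') n := by
  have hT0 : (T : ℂ) ≠ 0 := by exact_mod_cast hT.out.ne'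
  have e : ∀ (k : ℝ → ℝ) (hc : Continuous k) (hp : Function.Periodic k T),
      fourierCoeff (circleLift k hc hp) n = fourierCoeffOn hT.out (fun x => (k x : ℂ)) n := by
    intro k hc hp
    rw [fourierCoeff_eq_intervalIntegral _ _ 0, fourierCoeffOn_eq_integral]
    simp only [zero_add, sub_zero, circleLift_coe, fourier_coe_apply]
  have h1 := fourierCoeffOn_of_hasDerivAt hT.out (f := fun x => (h x : ℂ))
    (f' := fun x => ((deriv h x : ℝ) : ℂ)) hn
    (fun x _ => ((hh.differentiable one_ne_zero x).hasDerivAt).ofReal_comp)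
    ((Complex.continuous_ofReal.comp hc').intervalIntegrable _ _)
  rw [e, e, h1]
  have h2 : h T = h 0 := by simpa using hper 0
  have hn' : (n : ℂ) ≠ 0 := by exact_mod_cast hn
  have hpi : (Real.pi : ℂ) ≠ 0 := by exact_mod_cast Real.pi_ne_zero
  rw [h2]
  field_simp
  simp

theorem fourierCoeff_comp_const_add {T : ℝ} [Fact (0 < T)] (F : C(AddCircle T, ℂ))
    (s : AddCircle T) (n : ℤ) :
    fourierCoeff (fun t => F (s + t)) n = fourier n s * fourierCoeff F n := by
  rw [fourierCoeff, fourierCoeff, ← integral_const_mul,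
    ← integral_add_left_eq_self (fun t => fourier n s * (fourier (-n) t • F t)) s]
  refine integral_congr_ae (ae_of_all _ fun t => ?_)
  have h1 : (fourier n s : ℂ) * fourier (-n) s = 1 := by
    rw [← fourier_add]; simp
  have h2 : (fourier (-n) (s + t) : ℂ) = fourier (-n) s * fourier (-n) t := by
    simp only [fourier_apply, smul_add, AddCircle.toCircle_add, Circle.coe_mul]
  simp only [smul_eq_mul]
  rw [h2]
  linear_combination (-(fourier (-n) t : ℂ) * F (s + t)) * h1

/-- A square summable sequence is realised as the sequence of multipliers of an integral
functional on continuous functions on the circle. -/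
theorem exists_integrable_hasSum_fourierCoeff {T : ℝ} [hT : Fact (0 < T)] {a : ℤ → ℂ}
    (ha : Summable fun n => ‖a n‖ ^ 2) :
    ∃ K : AddCircle T → ℂ, Integrable K AddCircle.haarAddCircle ∧ ∀ F : C(AddCircle T, ℂ),
      HasSum (fun n => a n * fourierCoeff F n) (∫ t, K t * F t ∂AddCircle.haarAddCircle) := by
  have hb : Memℓp (fun n => star (a n)) 2 := by
    refine memℓp_gen ?_
    simpa using ha
  let b : lp (fun _ : ℤ => ℂ) 2 := ⟨_, hb⟩
  let κ : Lp ℂ 2 (@AddCircle.haarAddCircle T hT) := fourierBasis.repr.symm b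
  have hκ : ∀ n, fourierBasis.repr κ n = star (a n) := fun n => by
    simp only [κ, LinearIsometryEquiv.apply_symm_apply]; rfl
  refine ⟨fun t => star (κ t), ?_, fun F => ?_⟩
  · have h1 : Integrable κ AddCircle.haarAddCircle :=
      (Lp.memLp κ).integrable (by norm_num)
    exact (LinearIsometryEquiv.integrable_comp_iff
      (RCLike.conjLIE : ℂ ≃ₗᵢ[ℝ] ℂ)).mpr h1
  · have h1 := fourierBasis.hasSum_inner_mul_inner κ
      (ContinuousMap.toLp (E := ℂ) 2 AddCircle.haarAddCircle ℂ F)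
    have h2 : inner ℂ κ (ContinuousMap.toLp (E := ℂ) 2 AddCircle.haarAddCircle ℂ F)
        = ∫ t, star (κ t) * F t ∂AddCircle.haarAddCircle := by
      rw [L2.inner_def]
      refine integral_congr_ae ?_
      filter_upwards [ContinuousMap.coeFn_toLp (p := 2) (𝕜 := ℂ) AddCircle.haarAddCircle F]
        with t ht
      rw [ht, RCLike.inner_apply']
      rfl
    rw [h2] at h1
    convert! h1 using 2 with n
    rw [← HilbertBasis.repr_apply_apply, fourierBasis_repr, fourierCoeff_toLp,
      ← inner_conj_symm, ← HilbertBasis.repr_apply_apply, hκ]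
    simp

/-- A bounded inverse, after two derivatives, of the difference operator
`g ↦ g - g (· + ω T)` on mean-zero `T`-periodic functions. -/
theorem exists_kernel_cohomological {T ω γ τ : ℝ} (hT : 0 < T) (hωirr : Irrational ω)
    (hτ0 : 0 < τ) (hτ2 : τ < 2) (hγ : 0 < γ)
    (hdio : ∀ m n : ℤ, (m, n) ≠ (0, 0) → γ / |(m : ℝ)| ^ τ ≤ |(m : ℝ) * ω + (n : ℝ)|) :
    ∃ K : ℝ → ℝ, IntervalIntegrable K volume 0 T ∧ ∀ h : ℝ → ℝ, ContDiff ℝ 2 h →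
      Function.Periodic h T → ∫ x in (0 : ℝ)..T, h x = 0 → ∀ s : ℝ,
        (∫ x in (0 : ℝ)..T, K x * deriv (deriv h) (s + ω * T + x))
          = (∫ x in (0 : ℝ)..T, K x * deriv (deriv h) (s + x)) - h s := by
  have : Fact (0 < T) := ⟨hT⟩
  have hT0 : (T : ℂ) ≠ 0 := by exact_mod_cast hT.ne'
  have hpi : (Real.pi : ℂ) ≠ 0 := by exact_mod_cast Real.pi_ne_zero
  set e : ℤ → ℂ := fun n => Complex.exp (2 * Real.pi * Complex.I * ((n * ω : ℝ) : ℂ)) with he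
  have hx0 : ∀ n : ℤ, n ≠ 0 → (n : ℝ) * ω - round ((n : ℝ) * ω) ≠ 0 := by
    intro n hn h0
    have := (hωirr.intCast_mul hn)
    exact this ⟨round ((n : ℝ) * ω), by push_cast; linarith⟩
  have he0 : ∀ n : ℤ, n ≠ 0 → e n - 1 ≠ 0 := by
    intro n hn h0
    have h1 := norm_exp_two_pi_sub_one_ge ((n : ℝ) * ω)
    simp only [he] at h0
    rw [h0, norm_zero] at h1
    have := abs_pos.mpr (hx0 n hn)
    linarith
  set a : ℤ → ℂ := fun n => -((2 * Real.pi * Complex.I * n / T) ^ 2 * (e n - 1))⁻¹ with ha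
  have hsum : Summable fun n => ‖a n‖ ^ 2 := by
    refine ((summable_inv_pow_four_mul_inv_sq_dist_round hτ0 hτ2 hγ hdio).mul_left
      ((T / (2 * Real.pi)) ^ 4 * (1 / 16))).of_nonneg_of_le (fun n => by positivity) fun n => ?_
    by_cases hn : n = 0
    · simp [ha, hn]
    have h1 := norm_exp_two_pi_sub_one_ge ((n : ℝ) * ω)
    have h2 := abs_pos.mpr (hx0 n hn)
    have h3 : ‖(2 * Real.pi * Complex.I * n / T : ℂ)‖ = 2 * Real.pi * |(n : ℝ)| / T := by
      simp [abs_of_pos Real.pi_pos, abs_of_pos hT]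
    have hn' : 0 < |(n : ℝ)| := by positivity
    have hpi' := Real.pi_pos
    calc ‖a n‖ ^ 2 = ((2 * Real.pi * |(n : ℝ)| / T) ^ 4)⁻¹ * (‖e n - 1‖ ^ 2)⁻¹ := by
          simp only [ha, norm_neg, norm_inv, norm_mul, norm_pow, h3]
          rw [inv_pow, mul_pow, ← pow_mul, mul_inv]
      _ ≤ ((2 * Real.pi * |(n : ℝ)| / T) ^ 4)⁻¹ *
            ((4 * |(n : ℝ) * ω - round ((n : ℝ) * ω)|) ^ 2)⁻¹ := by
          gcongr
      _ = _ := by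
          rw [mul_pow 4 _ 2, sq_abs, div_pow, mul_pow (2 * Real.pi) _ 4,
            Even.pow_abs (by decide) (n : ℝ)]
          have h4 := hx0 n hn
          have h5 : (n : ℝ) ≠ 0 := by exact_mod_cast hn
          field_simp
          norm_num
  obtain ⟨K, hK, hKsum⟩ := exists_integrable_hasSum_fourierCoeff (T := T) hsum
  have hmp := AddCircle.measurePreserving_mk T 0
  rw [zero_add] at hmp
  have hKv : Integrable K volume := by
    rw [AddCircle.volume_eq_smul_haarAddCircle]
    exact hK.smul_measure ENNReal.ofReal_ne_top
  have hKi : IntervalIntegrable (fun x : ℝ => K x) volume 0 T := by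
    rw [intervalIntegrable_iff_integrableOn_Ioc_of_le hT.le]
    exact hmp.integrable_comp_of_integrable hKv
  refine ⟨fun x => T⁻¹ * (K x).re, ?_, ?_⟩
  · rw [intervalIntegrable_iff_integrableOn_Ioc_of_le hT.le] at hKi ⊢
    exact hKi.re.const_mul _
  intro h hh hper hmean s
  have hd1 : ContDiff ℝ 1 (deriv h) := (contDiff_succ_iff_deriv (n := 1).mp hh).2.2
  have hd2 : Continuous (deriv (deriv h)) := hd1.continuous_deriv le_rfl
  have hp1 : Function.Periodic (deriv h) T := fun x => by
    rw [← deriv_comp_add_const]; simp only [hper _]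
  have hp2 : Function.Periodic (deriv (deriv h)) T := fun x => by
    rw [← deriv_comp_add_const]; simp only [hp1 _]
  set F := circleLift h hh.continuous hper with hF
  set F2 := circleLift (deriv (deriv h)) hd2 hp2 with hF2
  have hre : ∀ u : ℝ, (∫ x in (0 : ℝ)..T, T⁻¹ * (K x).re * deriv (deriv h) (u + x))
      = (∫ t, K t * F2 (u + t) ∂AddCircle.haarAddCircle).re := by
    intro u
    rw [AddCircle.integral_haarAddCircle]
    have h1 := AddCircle.intervalIntegral_preimage T 0 (fun t => K t * F2 (u + t))
    rw [← h1, zero_add, Complex.smul_re, ← RCLike.re_eq_complex_re,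
      ← intervalIntegral.intervalIntegral_re, smul_eq_mul, ← intervalIntegral.integral_const_mul]
    · refine intervalIntegral.integral_congr fun x _ => ?_
      have : F2 ((u : AddCircle T) + x) = ((deriv (deriv h) (u + x) : ℝ) : ℂ) := by
        rw [hF2, ← AddCircle.coe_add, circleLift_coe]
      simp only [this]
      simp [mul_assoc]
    · exact hKi.mul_continuousOn (by fun_prop)
  have hG : ∀ u : AddCircle T, HasSum (fun n => a n * (fourier n u * fourierCoeff F2 n))
      (∫ t, K t * F2 (u + t) ∂AddCircle.haarAddCircle) := by
    intro u
    have h1 := hKsum ⟨fun t => F2 (u + t), by fun_prop⟩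
    convert! h1 using 3 with n
    exact (fourierCoeff_comp_const_add F2 u n).symm
  have hc : ∀ n : ℤ, n ≠ 0 → fourierCoeff F n
      = (T / (2 * Real.pi * Complex.I * n)) ^ 2 * fourierCoeff F2 n := by
    intro n hn
    rw [hF, fourierCoeff_circleLift_deriv (hh.of_le (by norm_num)) hper hd1.continuous hp1 hn,
      fourierCoeff_circleLift_deriv hd1 hp1 hd2 hp2 hn]
    ring
  have hc0 : fourierCoeff F 0 = 0 := by
    rw [fourierCoeff_eq_intervalIntegral _ _ 0]
    have : ∀ x : ℝ, F x = (h x : ℂ) := fun x => rfl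
    simp [this, intervalIntegral.integral_ofReal, hmean]
  have hdiff : ∀ u : ℝ, HasSum (fun n => -(fourierCoeff F n * fourier n (u : AddCircle T)))
      ((∫ t, K t * F2 (((u + ω * T : ℝ) : AddCircle T) + t) ∂AddCircle.haarAddCircle) -
        ∫ t, K t * F2 ((u : AddCircle T) + t) ∂AddCircle.haarAddCircle) := by
    intro u
    convert! (hG ((u + ω * T : ℝ) : AddCircle T)).sub (hG (u : AddCircle T)) using 2 with n
    by_cases hn : n = 0
    · simp [hn, hc0, ha]
    have h1 : (fourier n ((u + ω * T : ℝ) : AddCircle T) : ℂ)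
        = e n * fourier n (u : AddCircle T) := by
      rw [fourier_coe_apply, fourier_coe_apply, he, ← Complex.exp_add]
      congr 1
      push_cast
      field_simp
      ring
    rw [h1, hc n hn]
    have hn' : (n : ℂ) ≠ 0 := by exact_mod_cast hn
    have h2 := he0 n hn
    simp only [ha]
    field_simp
    ring
  have hFs : Summable (fourierCoeff F) := by
    have h1 := (hdiff 0).summable.neg
    simpa using h1
  have hlim := (has_pointwise_sum_fourier_series_of_summable hFs (s : AddCircle T)).neg
  have hfin := (hdiff s).unique hlim
  have hFs' : F (s : AddCircle T) = (h s : ℂ) := rfl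
  rw [hFs'] at hfin
  have := congrArg Complex.re hfin
  rw [Complex.sub_re] at this
  rw [hre, hre]
  simp only [Complex.neg_re, Complex.ofReal_re] at this
  linarith

theorem exists_bound_closedBall_uIcc {H V : Type*} [NormedAddCommGroup H] [ProperSpace H]
    [NormedAddCommGroup V]
    {F : H → ℝ → V}
    (hF : Continuous fun z : H × ℝ => F z.1 z.2) (x₀ : H) (a b : ℝ) :
    ∃ M, ∀ x ∈ Metric.closedBall x₀ 1, ∀ t ∈ uIcc a b, ‖F x t‖ ≤ M := by
  obtain ⟨M, hM⟩ := ((isCompact_closedBall x₀ 1).prod isCompact_uIcc).exists_bound_of_continuousOn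
    hF.continuousOn
  exact ⟨M, fun x hx t ht => hM (x, t) ⟨hx, ht⟩⟩

theorem intervalIntegrable_weight_smul {V : Type*} [NormedAddCommGroup V] [NormedSpace ℝ V]
    {a b : ℝ} {K : ℝ → ℝ}
    {F : ℝ → V} (hK : IntervalIntegrable K volume a b)
    (hF : Continuous F) : IntervalIntegrable (fun t => K t • F t) volume a b :=
  hK.smul_continuousOn hF.continuousOn

theorem continuous_weighted_integral {H V : Type*} [NormedAddCommGroup H] [ProperSpace H]
    [NormedAddCommGroup V] [NormedSpace ℝ V] {a b : ℝ} {K : ℝ → ℝ}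
    (hK : IntervalIntegrable K volume a b) {F : H → ℝ → V}
    (hF : Continuous fun z : H × ℝ => F z.1 z.2) :
    Continuous fun x => ∫ t in a..b, K t • F x t := by
  rw [continuous_iff_continuousAt]
  intro x₀
  obtain ⟨M, hM⟩ := exists_bound_closedBall_uIcc hF x₀ a b
  have hFx : ∀ x, Continuous (F x) := fun x => by fun_prop
  refine intervalIntegral.continuousAt_of_dominated_interval (bound := fun t => ‖K t‖ * M)
    (Eventually.of_forall fun x =>
      (intervalIntegrable_weight_smul hK (hFx x)).def'.aestronglyMeasurable)
    ?_ (hK.norm.mul_const M) ?_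
  · filter_upwards [Metric.closedBall_mem_nhds x₀ one_pos] with x hx
    refine ae_of_all _ fun t ht => ?_
    rw [norm_smul]
    gcongr
    exact hM x hx t (uIoc_subset_uIcc ht)
  · refine ae_of_all _ fun t _ => ?_
    have : Continuous fun x => K t • F x t := by fun_prop
    exact this.continuousAt

theorem hasFDerivAt_weighted_integral {H V : Type*} [NormedAddCommGroup H] [NormedSpace ℝ H]
    [ProperSpace H]
    [NormedAddCommGroup V] [NormedSpace ℝ V] {a b : ℝ} {K : ℝ → ℝ}
    (hK : IntervalIntegrable K volume a b) {F : H → ℝ → V}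
    (hF : ContDiff ℝ 1 fun z : H × ℝ => F z.1 z.2) (x₀ : H) :
    HasFDerivAt (fun x => ∫ t in a..b, K t • F x t)
      (∫ t in a..b, K t • fderiv ℝ (fun x => F x t) x₀) x₀ := by
  have hF' : Continuous fun z : H × ℝ => fderiv ℝ (fun x => F x z.2) z.1 := by
    have : ContDiff ℝ 1 (Function.uncurry fun (z : H × ℝ) (x : H) => F x z.2) :=
      hF.comp (contDiff_snd.prodMk (contDiff_snd.comp contDiff_fst))
    exact (this.fderiv (n := 0) contDiff_fst le_rfl).continuous
  obtain ⟨M, hM⟩ := exists_bound_closedBall_uIcc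
    (F := fun x t => fderiv ℝ (fun x => F x t) x) hF' x₀ a b
  have hFx : ∀ x, Continuous (F x) := fun x => by
    have := hF.continuous
    fun_prop
  have hFx' : ∀ x, Continuous fun t => fderiv ℝ (fun x => F x t) x := fun x =>
    hF'.comp (by fun_prop : Continuous fun t : ℝ => (x, t))
  refine intervalIntegral.hasFDerivAt_integral_of_dominated_of_fderiv_le
    (F' := fun x t => K t • fderiv ℝ (fun x => F x t) x)
    (bound := fun t => ‖K t‖ * M) (Metric.closedBall_mem_nhds x₀ one_pos)
    (Eventually.of_forall fun x =>
      (intervalIntegrable_weight_smul hK (hFx x)).def'.aestronglyMeasurable)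
    (intervalIntegrable_weight_smul hK (hFx x₀))
    (intervalIntegrable_weight_smul hK (hFx' x₀)).def'.aestronglyMeasurable
    ?_ (hK.norm.mul_const M) ?_
  · refine ae_of_all _ fun t ht x hx => ?_
    rw [norm_smul]
    gcongr
    exact hM x hx t (uIoc_subset_uIcc ht)
  · refine ae_of_all _ fun t _ x _ => ?_
    have h1 : ContDiff ℝ 1 fun x => F x t := hF.comp (contDiff_id.prodMk contDiff_const)
    exact ((h1.differentiable one_ne_zero x).hasFDerivAt).const_smul (K t)

theorem contDiff_weighted_integral {H : Type} [NormedAddCommGroup H] [NormedSpace ℝ H]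
    [ProperSpace H]
    {a b : ℝ} {K : ℝ → ℝ}
    (hK : IntervalIntegrable K volume a b) (n : ℕ) :
    ∀ {V : Type} [NormedAddCommGroup V] [NormedSpace ℝ V] {F : H → ℝ → V},
      ContDiff ℝ n (fun z : H × ℝ => F z.1 z.2) →
      ContDiff ℝ n fun x => ∫ t in a..b, K t • F x t := by
  induction n with
  | zero =>
    intro V _ _ F hF
    rw [Nat.cast_zero, contDiff_zero] at hF ⊢
    exact continuous_weighted_integral hK hF
  | succ n ih =>
    intro V _ _ F hF
    have hF' : ContDiff ℝ n fun z : H × ℝ => fderiv ℝ (fun x => F x z.2) z.1 := by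
      have : ContDiff ℝ (n + 1 : ℕ) (Function.uncurry fun (z : H × ℝ) (x : H) => F x z.2) :=
        hF.comp (contDiff_snd.prodMk (contDiff_snd.comp contDiff_fst))
      exact this.fderiv (n := n) contDiff_fst (by push_cast; exact le_rfl)
    push_cast
    rw [contDiff_succ_iff_hasFDerivAt]
    exact ⟨_, ih hF', fun x => hasFDerivAt_weighted_integral hK
      (hF.of_le (by push_cast; exact le_add_self)) x⟩

theorem hasDerivAt_weighted_integral {a b : ℝ} {K : ℝ → ℝ}
    (hK : IntervalIntegrable K volume a b) {F : ℝ → ℝ → ℝ}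
    (hF : ContDiff ℝ 1 fun z : ℝ × ℝ => F z.1 z.2) (x₀ : ℝ) :
    HasDerivAt (fun x => ∫ t in a..b, K t * F x t)
      (∫ t in a..b, K t * deriv (fun x => F x t) x₀) x₀ := by
  have hF' : Continuous fun t : ℝ => fderiv ℝ (fun x => F x t) x₀ := by
    have : ContDiff ℝ 1 (Function.uncurry fun (t : ℝ) (x : ℝ) => F x t) :=
      hF.comp (contDiff_snd.prodMk contDiff_fst)
    exact (this.fderiv (n := 0) contDiff_const le_rfl).continuous
  have h1 := (hasFDerivAt_weighted_integral hK hF x₀).hasDerivAt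
  rw [ContinuousLinearMap.intervalIntegral_apply (intervalIntegrable_weight_smul hK hF')] at h1
  simpa using h1

theorem contDiff_iteratedDeriv_snd {H V : Type} [NormedAddCommGroup H] [NormedSpace ℝ H]
    [NormedAddCommGroup V] [NormedSpace ℝ V]
    (k n : ℕ) {F : H → ℝ → V}
    (hF : ContDiff ℝ (n + k : ℕ) fun z : H × ℝ => F z.1 z.2) :
    ContDiff ℝ n fun z : H × ℝ => iteratedDeriv k (F z.1) z.2 := by
  induction k generalizing F with
  | zero => simpa using hF
  | succ k ih =>
    simp only [iteratedDeriv_succ']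
    refine ih (F := fun x => deriv (F x)) ?_
    have : ContDiff ℝ (n + (k + 1) : ℕ) (Function.uncurry fun (z : H × ℝ) (t : ℝ) => F z.1 t) :=
      hF.comp ((contDiff_fst.comp contDiff_fst).prodMk contDiff_snd)
    exact (this.fderiv (n := (n + k : ℕ)) contDiff_snd (by push_cast; rw [add_assoc])).clm_apply
      contDiff_const

theorem iteratedDeriv_weighted_integral {a b : ℝ} {K : ℝ → ℝ}
    (hK : IntervalIntegrable K volume a b) (k : ℕ)
    {F : ℝ → ℝ → ℝ} (hF : ContDiff ℝ k fun z : ℝ × ℝ => F z.1 z.2) (x : ℝ) :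
    iteratedDeriv k (fun x => ∫ t in a..b, K t * F x t) x
      = ∫ t in a..b, K t * iteratedDeriv k (fun x => F x t) x := by
  induction k generalizing F with
  | zero => simp
  | succ k ih =>
    have h1 : deriv (fun x => ∫ t in a..b, K t * F x t)
        = fun x => ∫ t in a..b, K t * deriv (fun x => F x t) x :=
      funext fun x => (hasDerivAt_weighted_integral hK
        (hF.of_le (by push_cast; exact le_add_self)) x).deriv
    rw [iteratedDeriv_succ', h1, ih]
    · simp only [iteratedDeriv_succ']
    · have h2 := contDiff_iteratedDeriv_snd 1 k (F := fun t x => F x t)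
        (hF.comp (contDiff_snd.prodMk contDiff_fst))
      simp only [iteratedDeriv_one] at h2
      exact h2.comp (contDiff_snd.prodMk contDiff_fst)

theorem iterD_weighted_integral {a b : ℝ} {K : ℝ → ℝ} (hK : IntervalIntegrable K volume a b)
    {F : ℝ → ℝ → ℝ → ℝ} (i j : ℕ)
    (hF : ContDiff ℝ (i + j : ℕ) fun z : ℝ × ℝ × ℝ => F z.1 z.2.1 z.2.2) (x y : ℝ) :
    iterD (fun x y => ∫ t in a..b, K t * F x y t) i j x y
      = ∫ t in a..b, K t * iterD (fun x y => F x y t) i j x y := by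
  have h1 : ∀ x, iteratedDeriv j (fun y => ∫ t in a..b, K t * F x y t) y
      = ∫ t in a..b, K t * iteratedDeriv j (fun y => F x y t) y := fun x =>
    iteratedDeriv_weighted_integral hK j (F := F x)
      ((hF.of_le (by norm_cast; omega)).comp (by fun_prop :
        ContDiff ℝ _ fun z : ℝ × ℝ => (x, z.1, z.2))) y
  unfold iterD
  simp only [h1]
  refine iteratedDeriv_weighted_integral hK i (F := fun x t => iteratedDeriv j (fun y => F x y t) y)
    ?_ x
  have h2 := contDiff_iteratedDeriv_snd (H := ℝ × ℝ) j i (F := fun z s => F z.1 s z.2)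
    (hF.comp (by fun_prop : ContDiff ℝ _ fun z : (ℝ × ℝ) × ℝ => (z.1.1, z.2, z.1.2)))
  exact h2.comp (by fun_prop : ContDiff ℝ _ fun z : ℝ × ℝ => (z, y))

theorem abs_iterD_weighted_integral_le {a b : ℝ} (hab : a ≤ b) {K : ℝ → ℝ}
    (hK : IntervalIntegrable K volume a b)
    {F : ℝ → ℝ → ℝ → ℝ} (i j : ℕ)
    (hF : ContDiff ℝ (i + j : ℕ) fun z : ℝ × ℝ × ℝ => F z.1 z.2.1 z.2.2) {x y B : ℝ}
    (hB : ∀ t, |iterD (fun x y => F x y t) i j x y| ≤ B) :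
    |iterD (fun x y => ∫ t in a..b, K t * F x y t) i j x y| ≤ (∫ t in a..b, |K t|) * B := by
  rw [iterD_weighted_integral hK i j hF, ← intervalIntegral.integral_mul_const, ← Real.norm_eq_abs]
  refine intervalIntegral.norm_integral_le_of_norm_le hab (ae_of_all _ fun t _ => ?_)
    (hK.abs.mul_const B)
  rw [Real.norm_eq_abs, abs_mul]
  gcongr
  exact hB t

theorem iterD_comp_add_const (F : ℝ → ℝ → ℝ) (i j : ℕ) (c x y : ℝ) :
    iterD (fun x y => F x (y + c)) i j x y = iterD F i j x (y + c) := by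
  unfold iterD
  congr 1
  funext x
  rw [iteratedDeriv_comp_add_const]

theorem iterD_deriv_deriv (F : ℝ → ℝ → ℝ) (i j : ℕ) (x y : ℝ) :
    iterD (fun x => deriv (deriv (F x))) i j x y = iterD F i (j + 2) x y := by
  simp only [iterD, iteratedDeriv_succ']

theorem iterD_sub {F G : ℝ → ℝ → ℝ} {i j : ℕ}
    (hF : ContDiff ℝ (i + j : ℕ) fun z : ℝ × ℝ => F z.1 z.2)
    (hG : ContDiff ℝ (i + j : ℕ) fun z : ℝ × ℝ => G z.1 z.2) (x y : ℝ) :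
    iterD (fun x y => F x y - G x y) i j x y = iterD F i j x y - iterD G i j x y := by
  have hx : ∀ {F : ℝ → ℝ → ℝ}, (ContDiff ℝ (i + j : ℕ) fun z : ℝ × ℝ => F z.1 z.2) →
      ∀ x, ContDiff ℝ j (F x) := fun hF x =>
    (hF.of_le (by norm_cast; omega)).comp (by fun_prop : ContDiff ℝ _ fun y : ℝ => (x, y))
  have hy : ∀ {F : ℝ → ℝ → ℝ}, (ContDiff ℝ (i + j : ℕ) fun z : ℝ × ℝ => F z.1 z.2) →
      ContDiff ℝ i fun x => iteratedDeriv j (F x) y := fun hF =>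
    (contDiff_iteratedDeriv_snd j i hF).comp (by fun_prop : ContDiff ℝ _ fun x : ℝ => (x, y))
  have h1 : ∀ x, iteratedDeriv j (fun y => F x y - G x y) y
      = iteratedDeriv j (F x) y - iteratedDeriv j (G x) y := fun x =>
    iteratedDeriv_sub (hx hF x).contDiffAt (hx hG x).contDiffAt
  unfold iterD
  simp only [h1]
  exact iteratedDeriv_sub (hy hF).contDiffAt (hy hG).contDiffAt

/-- Mean-zero solution of the linear equation `ω ∂_s S + ∂_θ S + R = 0` on the torus, obtained by
integrating along characteristics and solving a cohomological equation on the circle. -/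
theorem exists_solution_of_mean_zero {T ω γ τ : ℝ} (hT : 0 < T) (hωirr : Irrational ω)
    (hτ0 : 0 < τ) (hτ2 : τ < 2) (hγ : 0 < γ)
    (hdio : ∀ m n : ℤ, (m, n) ≠ (0, 0) → γ / |(m : ℝ)| ^ τ ≤ |(m : ℝ) * ω + (n : ℝ)|)
    {l : ℕ} (hl : 3 ≤ l) {R : ℝ → ℝ → ℝ → ℝ}
    (hR : ContDiff ℝ l fun z : ℝ × ℝ × ℝ => R z.1 z.2.1 z.2.2)
    (hRs : ∀ r s θ, R r (s + T) θ = R r s θ) (hRθ : ∀ r s θ, R r s (θ + T) = R r s θ)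
    (hmean : ∀ r, ∫ s in (0 : ℝ)..T, ∫ θ in (0 : ℝ)..T, R r s θ = 0) :
    ∃ S : ℝ → ℝ → ℝ → ℝ,
      (∀ r s θ, S r (s + T) θ = S r s θ) ∧ (∀ r s θ, S r s (θ + T) = S r s θ) ∧
      (∀ r s θ, ω * deriv (fun s' => S r s' θ) s + deriv (fun θ' => S r s θ') θ + R r s θ = 0) ∧
      ∃ C' : ℝ, 0 < C' ∧ ∀ i j : ℕ, i + j ≤ l - 2 → ∀ r B : ℝ,
        (∀ j' ≤ j + 2, ∀ s θ, |iterD (fun r s => R r s θ) i j' r s| ≤ B) →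
        ∀ s θ, |iterD (fun r s => S r s θ) i j r s| ≤ C' * B := by
  obtain ⟨K, hK, hKeq⟩ := exists_kernel_cohomological hT hωirr hτ0 hτ2 hγ hdio
  have hone : ∀ a b : ℝ, IntervalIntegrable (fun _ : ℝ => (1 : ℝ)) volume a b := fun a b => by simp
  have hRc : Continuous fun z : ℝ × ℝ × ℝ => R z.1 z.2.1 z.2.2 := hR.continuous
  have hRsh : ContDiff ℝ l fun z : ℝ × ℝ × ℝ => R z.1 (z.2.1 + ω * z.2.2) z.2.2 :=
    hR.comp (by fun_prop : ContDiff ℝ _ fun z : ℝ × ℝ × ℝ => (z.1, z.2.1 + ω * z.2.2, z.2.2))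
  set h : ℝ → ℝ → ℝ := fun r s => ∫ t in (0 : ℝ)..T, 1 * R r (s + ω * t) t with hh
  have hhC : ContDiff ℝ l fun z : ℝ × ℝ => h z.1 z.2 :=
    contDiff_weighted_integral (H := ℝ × ℝ) (hone 0 T) l
      (F := fun z t => R z.1 (z.2 + ω * t) t)
      (hRsh.comp (by fun_prop : ContDiff ℝ _ fun z : (ℝ × ℝ) × ℝ => (z.1.1, z.1.2, z.2)))
  have hhper : ∀ r, Function.Periodic (h r) T := fun r s => by
    simp only [hh]
    refine intervalIntegral.integral_congr fun t _ => ?_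
    rw [add_right_comm, hRs]
  have hhmean : ∀ r, ∫ s in (0 : ℝ)..T, h r s = 0 := by
    intro r
    have hswap : ∀ f : ℝ → ℝ → ℝ, Continuous (Function.uncurry f) →
        ∫ s in (0 : ℝ)..T, ∫ t in (0 : ℝ)..T, f s t = ∫ t in (0 : ℝ)..T, ∫ s in (0 : ℝ)..T, f s t :=
      fun f hf => intervalIntegral_intervalIntegral_swap
        ((hf.continuousOn.integrableOn_compact (isCompact_uIcc.prod isCompact_uIcc)).mono_set
          (prod_mono uIoc_subset_uIcc uIoc_subset_uIcc))
    simp only [hh, one_mul]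
    rw [hswap (fun s t => R r (s + ω * t) t)
      (hRc.comp (by fun_prop : Continuous fun z : ℝ × ℝ => (r, z.1 + ω * z.2, z.2)))]
    refine Eq.trans ?_ (hmean r)
    rw [hswap (fun s t => R r s t)
      (hRc.comp (by fun_prop : Continuous fun z : ℝ × ℝ => (r, z.1, z.2)))]
    refine intervalIntegral.integral_congr fun t _ => ?_
    have hp : Function.Periodic (fun s => R r s t) T := fun s => hRs r s t
    rw [intervalIntegral.integral_comp_add_right (fun s => R r s t), zero_add, add_comm T,
      hp.intervalIntegral_add_eq (ω * t) 0, zero_add]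
  have hh2 : ContDiff ℝ (l - 2 : ℕ) fun z : ℝ × ℝ => deriv (deriv (h z.1)) z.2 := by
    have h1 := contDiff_iteratedDeriv_snd (H := ℝ) 2 (l - 2) (F := h)
      (by rwa [Nat.sub_add_cancel (by omega)])
    simpa only [iteratedDeriv_succ', iteratedDeriv_zero] using h1
  set g : ℝ → ℝ → ℝ := fun r s => ∫ x in (0 : ℝ)..T, K x * deriv (deriv (h r)) (s + x) with hg
  have hh2' : ContDiff ℝ (l - 2 : ℕ)
      fun z : ℝ × ℝ × ℝ => deriv (deriv (h z.1)) (z.2.1 + z.2.2) :=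
    hh2.comp (by fun_prop : ContDiff ℝ _ fun z : ℝ × ℝ × ℝ => (z.1, z.2.1 + z.2.2))
  have hgC : ContDiff ℝ (l - 2 : ℕ) fun z : ℝ × ℝ => g z.1 z.2 :=
    contDiff_weighted_integral (H := ℝ × ℝ) hK (l - 2)
      (F := fun z t => deriv (deriv (h z.1)) (z.2 + t))
      (hh2'.comp (by fun_prop : ContDiff ℝ _ fun z : (ℝ × ℝ) × ℝ => (z.1.1, z.1.2, z.2)))
  have hgeq : ∀ r s, g r (s + ω * T) = g r s - h r s := fun r s =>
    hKeq (h r) ((hhC.of_le (by norm_cast; omega)).comp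
      (by fun_prop : ContDiff ℝ _ fun y : ℝ => (r, y))) (hhper r) (hhmean r) s
  have hgper : ∀ r s, g r (s + T) = g r s := by
    intro r s
    have hp1 : Function.Periodic (deriv (h r)) T := fun x => by
      rw [← deriv_comp_add_const]; simp only [hhper r _]
    have hp2 : Function.Periodic (deriv (deriv (h r))) T := fun x => by
      rw [← deriv_comp_add_const]; simp only [hp1 _]
    simp only [hg]
    refine intervalIntegral.integral_congr fun x _ => ?_
    rw [add_right_comm, hp2]
  set A : ℝ → ℝ → ℝ → ℝ := fun r u θ => ∫ t in (0 : ℝ)..θ, 1 * R r (u + ω * t) t with hA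
  have hRt : ∀ r u, Continuous fun t => 1 * R r (u + ω * t) t := fun r u =>
    continuous_const.mul (hRc.comp (by fun_prop : Continuous fun t : ℝ => (r, u + ω * t, t)))
  have hAC : ∀ θ, ContDiff ℝ l fun z : ℝ × ℝ => A z.1 z.2 θ := fun θ =>
    contDiff_weighted_integral (H := ℝ × ℝ) (hone 0 θ) l
      (F := fun z t => R z.1 (z.2 + ω * t) t)
      (hRsh.comp (by fun_prop : ContDiff ℝ _ fun z : (ℝ × ℝ) × ℝ => (z.1.1, z.1.2, z.2)))
  have hAC' : ∀ r, ContDiff ℝ 1 fun z : ℝ × ℝ => A r z.1 z.2 := by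
    intro r
    have e : ∀ u θ, A r u θ = θ * ∫ x in (0 : ℝ)..1, 1 * R r (u + ω * (θ * x)) (θ * x) := by
      intro u θ
      rw [intervalIntegral.mul_integral_comp_mul_left (f := fun t => 1 * R r (u + ω * t) t)]
      simp [hA]
    simp only [e]
    refine contDiff_snd.mul (contDiff_weighted_integral (H := ℝ × ℝ) (hone 0 1) 1
      (F := fun z x => R r (z.1 + ω * (z.2 * x)) (z.2 * x)) ?_)
    exact (hR.of_le (by norm_cast; omega)).comp (by fun_prop : ContDiff ℝ _
      fun z : (ℝ × ℝ) × ℝ => (r, z.1.1 + ω * (z.1.2 * z.2), z.1.2 * z.2))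
  have hAper : ∀ r u θ, A r (u + T) θ = A r u θ := fun r u θ => by
    simp only [hA]
    refine intervalIntegral.integral_congr fun t _ => ?_
    rw [add_right_comm, hRs]
  have hAadd : ∀ r u θ, A r u (θ + T) = h r u + A r (u + ω * T) θ := by
    intro r u θ
    simp only [hA, hh]
    rw [← intervalIntegral.integral_add_adjacent_intervals ((hRt r u).intervalIntegrable 0 T)
      ((hRt r u).intervalIntegrable T (θ + T))]
    congr 1
    have h1 := intervalIntegral.integral_comp_add_right (a := 0) (b := θ)
      (fun t => 1 * R r (u + ω * t) t) T
    rw [zero_add] at h1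
    rw [← h1]
    refine intervalIntegral.integral_congr fun t _ => ?_
    rw [hRθ]
    congr 2
    ring
  have hperθ : ∀ r s θ, g r (s - ω * (θ + T)) - A r (s - ω * (θ + T)) (θ + T)
      = g r (s - ω * θ) - A r (s - ω * θ) θ := by
    intro r s θ
    have h1 := hgeq r (s - ω * (θ + T))
    rw [hAadd]
    rw [show s - ω * (θ + T) + ω * T = s - ω * θ by ring] at h1 ⊢
    rw [h1]
    ring
  refine ⟨fun r s θ => g r (s - ω * θ) - A r (s - ω * θ) θ, ?_, hperθ, ?_, ?_⟩
  · intro r s θ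
    simp only
    rw [show s + T - ω * θ = s - ω * θ + T by ring, hgper, hAper]
  · intro r s θ
    set Φ : ℝ × ℝ → ℝ := fun z => g r (z.1 - ω * z.2) - A r (z.1 - ω * z.2) z.2 with hΦ
    have hΦd : Differentiable ℝ Φ := by
      have h1 : ContDiff ℝ 1 fun z : ℝ × ℝ => g r (z.1 - ω * z.2) :=
        (hgC.of_le (by norm_cast; omega)).comp
          (by fun_prop : ContDiff ℝ _ fun z : ℝ × ℝ => (r, z.1 - ω * z.2))
      have h2 : ContDiff ℝ 1 fun z : ℝ × ℝ => A r (z.1 - ω * z.2) z.2 :=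
        (hAC' r).comp (by fun_prop : ContDiff ℝ _ fun z : ℝ × ℝ => (z.1 - ω * z.2, z.2))
      exact (h1.sub h2).differentiable one_ne_zero
    have hL := (hΦd (s, θ)).hasFDerivAt
    set L := fderiv ℝ Φ (s, θ)
    have d1 : HasDerivAt (fun s' => Φ (s', θ)) (L (1, 0)) s :=
      HasFDerivAt.comp_hasDerivAt (f := fun s' : ℝ => (s', θ)) s hL
        ((hasDerivAt_id s).prodMk (hasDerivAt_const s θ))
    have d2 : HasDerivAt (fun θ' => Φ (s, θ')) (L (0, 1)) θ :=
      HasFDerivAt.comp_hasDerivAt (f := fun θ' : ℝ => (s, θ')) θ hL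
        ((hasDerivAt_const θ s).prodMk (hasDerivAt_id θ))
    have d3 : HasDerivAt (fun x => Φ (s - ω * θ + ω * x, x)) (L (ω, 1)) θ := by
      have hl : HasDerivAt (fun x : ℝ => (s - ω * θ + ω * x, x)) (ω, 1) θ := by
        have := (((hasDerivAt_id θ).const_mul ω).const_add (s - ω * θ)).prodMk (hasDerivAt_id θ)
        simpa using this
      refine HasFDerivAt.comp_hasDerivAt (l := Φ) (f := fun x : ℝ => (s - ω * θ + ω * x, x)) θ ?_ hl
      simpa using hL
    have d4 : HasDerivAt (fun x => Φ (s - ω * θ + ω * x, x)) (-R r s θ) θ := by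
      have e : (fun x => Φ (s - ω * θ + ω * x, x))
          = fun x => g r (s - ω * θ) - ∫ t in (0 : ℝ)..x, 1 * R r (s - ω * θ + ω * t) t := by
        funext x
        simp only [hΦ, hA, add_sub_cancel_right]
      rw [e]
      have := (intervalIntegral.integral_hasDerivAt_right
        ((hRt r (s - ω * θ)).intervalIntegrable 0 θ)
        (hRt r (s - ω * θ)).aestronglyMeasurable.stronglyMeasurableAtFilter
        (hRt r (s - ω * θ)).continuousAt).const_sub (g r (s - ω * θ))
      simpa using this
    have h5 : L (ω, 1) = ω * L (1, 0) + L (0, 1) := by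
      rw [← smul_eq_mul, ← map_smul, ← map_add]
      simp
    have h6 := d3.unique d4
    change ω * deriv (fun s' => Φ (s', θ)) s + deriv (fun θ' => Φ (s, θ')) θ + R r s θ = 0
    rw [d1.deriv, d2.deriv]
    linarith
  · have hKn : 0 ≤ ∫ t in (0 : ℝ)..T, |K t| :=
      intervalIntegral.integral_nonneg hT.le fun t _ => abs_nonneg _
    refine ⟨(∫ t in (0 : ℝ)..T, |K t|) * T + T, by positivity, ?_⟩
    intro i j hij r B hB s θ
    have hB0 : 0 ≤ B := (abs_nonneg _).trans (hB 0 (by omega) 0 0)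
    have hper : Function.Periodic
        (fun θ => fun r s => g r (s - ω * θ) - A r (s - ω * θ) θ) T := fun θ => by
      funext r s
      exact hperθ r s θ
    obtain ⟨θ', hθ', heq⟩ := hper.exists_mem_Ico₀ hT θ
    rw [heq]
    have hsub : iterD (fun r s => g r (s - ω * θ') - A r (s - ω * θ') θ') i j r s
        = iterD g i j r (s + -(ω * θ')) - iterD (fun r u => A r u θ') i j r (s + -(ω * θ')) := by
      rw [← iterD_comp_add_const, ← iterD_comp_add_const (fun r u => A r u θ')]
      simp only [← sub_eq_add_neg]
      refine iterD_sub ?_ ?_ r s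
      · exact (hgC.of_le (by norm_cast)).comp
          (by fun_prop : ContDiff ℝ _ fun z : ℝ × ℝ => (z.1, z.2 - ω * θ'))
      · exact ((hAC θ').of_le (by norm_cast; omega)).comp
          (by fun_prop : ContDiff ℝ _ fun z : ℝ × ℝ => (z.1, z.2 - ω * θ'))
    have hbd : ∀ b : ℝ, 0 ≤ b → b ≤ T → ∀ j' ≤ j + 2, ∀ u,
        |iterD (fun r u => ∫ t in (0 : ℝ)..b, 1 * R r (u + ω * t) t) i j' r u| ≤ T * B := by
      intro b hb hbT j' hj' u
      have h1 := abs_iterD_weighted_integral_le hb (hone 0 b)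
        (F := fun r u t => R r (u + ω * t) t) i j' (hRsh.of_le (by norm_cast; omega))
        (x := r) (y := u) (B := B) (fun t => by
          rw [iterD_comp_add_const (fun r s => R r s t)]
          exact hB j' hj' _ _)
      refine h1.trans ?_
      simp only [abs_one, intervalIntegral.integral_const, sub_zero, smul_eq_mul, mul_one]
      gcongr
    have hgb : ∀ u, |iterD g i j r u| ≤ (∫ t in (0 : ℝ)..T, |K t|) * (T * B) := by
      intro u
      refine abs_iterD_weighted_integral_le hT.le hK
        (F := fun r s x => deriv (deriv (h r)) (s + x)) i j (hh2'.of_le (by norm_cast))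
        (x := r) (y := u) (fun t => ?_)
      rw [iterD_comp_add_const (fun r s => deriv (deriv (h r)) s), iterD_deriv_deriv]
      exact hbd T hT.le le_rfl (j + 2) le_rfl _
    rw [hsub]
    calc _ ≤ _ := abs_sub _ _
      _ ≤ (∫ t in (0 : ℝ)..T, |K t|) * (T * B) + T * B :=
          add_le_add (hgb _) (hbd θ' hθ'.1 hθ'.2.le j (by omega) _)
      _ = _ := by ring

/-- **Lemma 3.3, existence of the generating function `S₃`.**
Let `ω` be a Diophantine irrational, `ε ≥ 0`, `l ≥ 4`, and let `𝓡(ϱ,s,θ)` be `C^l`,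
`2π_p`-periodic in `s` and `θ`, with `|D_ϱ^i D_s^j 𝓡| ≤ C ϱ^{-ε-i/q}` for
`0 ≤ i+j ≤ l` and large `ϱ`.  Then there is a function `S₃(ϱ,s,θ)`, `2π_p`-periodic
in `s` and `θ`, solving `ω ∂_s S₃ + ∂_θ S₃ + 𝓡 − [𝓡]₀ = 0` and satisfying
`|D_ϱ^i D_s^j S₃| ≤ C' ϱ^{-ε-i/q}` for `0 ≤ i+j ≤ l−2` and large `ϱ`. -/
theorem generating_function_S3
    (p q ω γ τ ε C : ℝ) (l : ℕ) (𝓡 : ℝ → ℝ → ℝ → ℝ)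
    (hp : 2 ≤ p) (hq : q = p / (p - 1))
    (hωirr : Irrational ω)
    (hτ1 : 1 < τ) (hτ2 : τ < 2) (hγ : 0 < γ)
    (hdio : ∀ m n : ℤ, (m, n) ≠ (0, 0) → γ / |(m : ℝ)| ^ τ ≤ |(m : ℝ) * ω + (n : ℝ)|)
    (hε : 0 ≤ ε) (hl : 4 ≤ l) (hC : 0 < C)
    (h𝓡 : ContDiff ℝ (l : ℕ∞) (fun z : ℝ × ℝ × ℝ => 𝓡 z.1 z.2.1 z.2.2))
    (h𝓡pers : ∀ ϱ s θ : ℝ, 𝓡 ϱ (s + 2 * pip p) θ = 𝓡 ϱ s θ)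
    (h𝓡perθ : ∀ ϱ s θ : ℝ, 𝓡 ϱ s (θ + 2 * pip p) = 𝓡 ϱ s θ)
    (h𝓡bd : ∃ ϱ₀ : ℝ, ∀ i j : ℕ, i + j ≤ l → ∀ ϱ : ℝ, ϱ₀ ≤ ϱ → ∀ s θ : ℝ,
      |iterD (fun ϱ s => 𝓡 ϱ s θ) i j ϱ s| ≤ C * ϱ ^ (-ε - (i : ℝ) / q)) :
    ∃ S₃ : ℝ → ℝ → ℝ → ℝ,
      (∀ ϱ s θ : ℝ, S₃ ϱ (s + 2 * pip p) θ = S₃ ϱ s θ) ∧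
      (∀ ϱ s θ : ℝ, S₃ ϱ s (θ + 2 * pip p) = S₃ ϱ s θ) ∧
      (∀ ϱ s θ : ℝ,
        ω * deriv (fun s' => S₃ ϱ s' θ) s + deriv (fun θ' => S₃ ϱ s θ') θ
          + 𝓡 ϱ s θ
          - (1 / (2 * pip p)) ^ 2 *
              ∫ s' in (0 : ℝ)..(2 * pip p), ∫ θ' in (0 : ℝ)..(2 * pip p), 𝓡 ϱ s' θ'
          = 0) ∧
      (∃ C' ϱ₁ : ℝ, 0 < C' ∧ ∀ i j : ℕ, i + j ≤ l - 2 → ∀ ϱ : ℝ, ϱ₁ ≤ ϱ → ∀ s θ : ℝ,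
        |iterD (fun ϱ s => S₃ ϱ s θ) i j ϱ s| ≤ C' * ϱ ^ (-ε - (i : ℝ) / q)) := by
  have hp0 : 0 < p := by linarith
  have hT : 0 < 2 * pip p := by
    have h1 : 0 < Real.sin (Real.pi / p) :=
      Real.sin_pos_of_pos_of_lt_pi (by positivity)
        (div_lt_self Real.pi_pos (by linarith))
    have h2 : 0 < (p - 1) ^ (1 / p) := Real.rpow_pos_of_pos (by linarith) _
    unfold pip
    positivity
  set T := 2 * pip p
  have hR : ContDiff ℝ l fun z : ℝ × ℝ × ℝ => 𝓡 z.1 z.2.1 z.2.2 := by exact_mod_cast h𝓡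
  have hRc := hR.continuous
  obtain ⟨ϱ₀, hbd⟩ := h𝓡bd
  have hw : IntervalIntegrable (fun _ : ℝ => T⁻¹) volume 0 T := by simp
  have hw1 : ∫ _ in (0 : ℝ)..T, |T⁻¹| = 1 := by
    rw [intervalIntegral.integral_const, abs_of_pos (inv_pos.mpr hT), sub_zero, smul_eq_mul,
      mul_inv_cancel₀ hT.ne']
  set Q : ℝ → ℝ → ℝ := fun r s => ∫ t in (0 : ℝ)..T, T⁻¹ * 𝓡 r s t with hQ
  have hQC : ContDiff ℝ l fun z : ℝ × ℝ => Q z.1 z.2 :=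
    contDiff_weighted_integral (H := ℝ × ℝ) hw l (F := fun z t => 𝓡 z.1 z.2 t)
      (hR.comp (by fun_prop : ContDiff ℝ _ fun z : (ℝ × ℝ) × ℝ => (z.1.1, z.1.2, z.2)))
  have hQsh : ContDiff ℝ l fun z : ℝ × ℝ × ℝ => Q z.1 (z.2.1 + z.2.2) :=
    hQC.comp (by fun_prop : ContDiff ℝ _ fun z : ℝ × ℝ × ℝ => (z.1, z.2.1 + z.2.2))
  set M : ℝ → ℝ → ℝ := fun r s => ∫ x in (0 : ℝ)..T, T⁻¹ * Q r (s + x) with hM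
  have hMC : ContDiff ℝ l fun z : ℝ × ℝ => M z.1 z.2 :=
    contDiff_weighted_integral (H := ℝ × ℝ) hw l (F := fun z x => Q z.1 (z.2 + x))
      (hQsh.comp (by fun_prop : ContDiff ℝ _ fun z : (ℝ × ℝ) × ℝ => (z.1.1, z.1.2, z.2)))
  have hMeq : ∀ r s, M r s
      = (1 / T) ^ 2 * ∫ s' in (0 : ℝ)..T, ∫ θ' in (0 : ℝ)..T, 𝓡 r s' θ' := by
    intro r s
    have hper : Function.Periodic (Q r) T := fun s => by simp only [hQ, h𝓡pers]
    simp only [hM]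
    rw [intervalIntegral.integral_const_mul, intervalIntegral.integral_comp_add_left (Q r),
      add_zero, hper.intervalIntegral_add_eq s 0, zero_add]
    simp only [hQ, intervalIntegral.integral_const_mul]
    ring
  have hmean : ∀ r, ∫ s in (0 : ℝ)..T, ∫ θ in (0 : ℝ)..T, (𝓡 r s θ - M r s) = 0 := by
    intro r
    have h1 : ∀ s, ∫ θ in (0 : ℝ)..T, (𝓡 r s θ - M r s) = T * Q r s - T * M r s := by
      intro s
      have hi : Continuous fun θ => 𝓡 r s θ :=
        hRc.comp (by fun_prop : Continuous fun θ : ℝ => (r, s, θ))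
      rw [intervalIntegral.integral_sub (hi.intervalIntegrable _ _) (by simp),
        intervalIntegral.integral_const]
      simp only [hQ, intervalIntegral.integral_const_mul, sub_zero, smul_eq_mul]
      rw [mul_inv_cancel_left₀ hT.ne']
    simp only [h1]
    have h2 : ∀ s, M r s = M r 0 := fun s => by rw [hMeq, hMeq]
    have h3 : M r 0 = T⁻¹ * ∫ s in (0 : ℝ)..T, Q r s := by
      simp only [hM, zero_add, intervalIntegral.integral_const_mul]
    have hi : Continuous fun s => T * Q r s := continuous_const.mul
      (hQC.continuous.comp (by fun_prop : Continuous fun s : ℝ => (r, s)))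
    simp only [h2]
    rw [intervalIntegral.integral_sub (hi.intervalIntegrable _ _) (by simp),
      intervalIntegral.integral_const, intervalIntegral.integral_const_mul, h3, smul_eq_mul,
      sub_zero, mul_inv_cancel_left₀ hT.ne', sub_self]
  have hbound : ∀ i j, i + j ≤ l → ∀ r, ϱ₀ ≤ r → ∀ s θ,
      |iterD (fun r s => 𝓡 r s θ - M r s) i j r s| ≤ 2 * (C * r ^ (-ε - (i : ℝ) / q)) := by
    intro i j hij r hr s θ
    have hle : ((i + j : ℕ) : WithTop ℕ∞) ≤ (l : ℕ) := by exact_mod_cast hij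
    have hQb : ∀ s, |iterD Q i j r s| ≤ C * r ^ (-ε - (i : ℝ) / q) := by
      intro s
      have := abs_iterD_weighted_integral_le hT.le hw i j (hR.of_le hle)
        fun t => hbd i j hij r hr s t
      rwa [hw1, one_mul] at this
    have hMb : |iterD M i j r s| ≤ C * r ^ (-ε - (i : ℝ) / q) := by
      have := abs_iterD_weighted_integral_le (F := fun r s x => Q r (s + x)) hT.le hw i j
        (hQsh.of_le hle) (x := r) (y := s) fun t => by
          rw [iterD_comp_add_const]
          exact hQb _
      rwa [hw1, one_mul] at this
    rw [iterD_sub (F := fun r s => 𝓡 r s θ) ((hR.of_le hle).comp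
      (by fun_prop : ContDiff ℝ _ fun z : ℝ × ℝ => (z.1, z.2, θ))) (hMC.of_le hle), two_mul]
    exact (abs_sub _ _).trans (add_le_add (hbd i j hij r hr s θ) hMb)
  obtain ⟨S, hSs, hSθ, hSeq, C', hC', hSbd⟩ := exists_solution_of_mean_zero hT hωirr
    (by linarith) hτ2 hγ hdio (by omega : 3 ≤ l) (R := fun r s θ => 𝓡 r s θ - M r s)
    (hR.sub (hMC.comp (by fun_prop : ContDiff ℝ _ fun z : ℝ × ℝ × ℝ => (z.1, z.2.1))))
    (fun r s θ => by simp only [h𝓡pers, hMeq]) (fun r s θ => by simp only [h𝓡perθ]) hmean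
  refine ⟨S, hSs, hSθ, fun r s θ => ?_, C' * (2 * C), ϱ₀, by positivity, ?_⟩
  · rw [← hMeq r s, ← hSeq r s θ]
    ring
  · intro i j hij r hr s θ
    have := hSbd i j hij r _ (fun j' hj' s θ => hbound i j' (by omega) r hr s θ) s θ
    rwa [mul_assoc, mul_assoc]
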